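/- Let K be a compact set of n×n real symmetric matrices and let C > 0. For every ε > 0 there exists Λ₀ > 0 such that for all λ ≥ Λ₀, all τ ∈ (0,1], all S ∈ K, and all b = (b_1, …, b_n) ∈ ℝⁿ with |b_j| ≤ C for all j, the (n+1)×(n+1) symmetric matrix A with A_{00} = λ/τ, A_{0j} = A_{j0} = b_j/√τ, and lower-right n×n block equal to S satisfies |ϑ(A) − (π/2 + ϑ(S))| < ε, where ϑ(N) denotes the sum of the arctangents of the eigenvalues of N. -/

import Mathlib

/-- The Lagrangian phase `ϑ(M) = ∑ arctan λ_j(M)` of a real symmetric matrix, where the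
`λ_j(M)` are its eigenvalues listed with multiplicity; `0` if `M` is not symmetric. -/
noncomputable def lagPhase {ι : Type*} [Fintype ι] [DecidableEq ι]
    (M : Matrix ι ι ℝ) : ℝ :=
  if h : M.IsHermitian then ∑ j, Real.arctan (h.eigenvalues j) else 0

/-- The `(n+1) × (n+1)` symmetric bordered matrix `[[a, b], [bᵀ, S]]`. -/
def borderedMat {n : ℕ} (a : ℝ) (b : Fin n → ℝ) (S : Matrix (Fin n) (Fin n) ℝ) :
    Matrix (Unit ⊕ Fin n) (Unit ⊕ Fin n) ℝ :=
  Matrix.fromBlocks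
    (Matrix.of fun (_ : Unit) (_ : Unit) => a)
    (Matrix.of fun (_ : Unit) j => b j)
    (Matrix.of fun i (_ : Unit) => b i)
    S

section

open Matrix Complex

/-- Spectral decomposition of a real symmetric matrix, read over `ℂ`. -/
theorem map_ofReal_eq_conj_diagonal {ι : Type*} [Fintype ι] [DecidableEq ι]
    {M : Matrix ι ι ℝ} (h : M.IsHermitian) :
    M.map ofReal = (h.eigenvectorUnitary : Matrix ι ι ℝ).map ofReal *
      diagonal (fun j => (h.eigenvalues j : ℂ)) *
      ((h.eigenvectorUnitary : Matrix ι ι ℝ).map ofReal)ᵀ := by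
  have h1 := h.spectral_theorem
  rw [Unitary.conjStarAlgAut_apply] at h1
  have h2 := congrArg (fun N : Matrix ι ι ℝ => N.map (ofRealHom : ℝ →+* ℂ)) h1
  simp only [Matrix.map_mul, Matrix.star_eq_conjTranspose, Matrix.conjTranspose_eq_transpose_of_trivial] at h2
  have h3 : diagonal (fun j => (h.eigenvalues j : ℂ)) =
      (diagonal (RCLike.ofReal ∘ h.eigenvalues) : Matrix ι ι ℝ).map ofRealHom := by
    ext i j
    by_cases hij : i = j <;> simp [hij]
  rw [h3]
  exact h2

theorem eigenvectorUnitary_map_mul_transpose {ι : Type*} [Fintype ι] [DecidableEq ι]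
    {M : Matrix ι ι ℝ} (h : M.IsHermitian) :
    (h.eigenvectorUnitary : Matrix ι ι ℝ).map ofReal *
      ((h.eigenvectorUnitary : Matrix ι ι ℝ).map ofReal)ᵀ = 1 := by
  have h1 := Unitary.mul_star_self_of_mem h.eigenvectorUnitary.2
  have h2 := congrArg (fun N : Matrix ι ι ℝ => N.map (ofRealHom : ℝ →+* ℂ)) h1
  simp only [Matrix.map_mul, Matrix.star_eq_conjTranspose, Matrix.conjTranspose_eq_transpose_of_trivial] at h2
  exact h2.trans (Matrix.map_one _ (map_zero _) (map_one _))

/-- `1 + z M` is diagonalised by the eigenvectors of `M`. -/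
theorem one_add_smul_map_ofReal_eq {ι : Type*} [Fintype ι] [DecidableEq ι]
    {M : Matrix ι ι ℝ} (h : M.IsHermitian) (z : ℂ) :
    1 + z • M.map ofReal = (h.eigenvectorUnitary : Matrix ι ι ℝ).map ofReal *
      diagonal (fun j => 1 + z * (h.eigenvalues j : ℂ)) *
      ((h.eigenvectorUnitary : Matrix ι ι ℝ).map ofReal)ᵀ := by
  have hd : diagonal (fun j => 1 + z * (h.eigenvalues j : ℂ)) =
      1 + z • diagonal (fun j => (h.eigenvalues j : ℂ)) := by
    ext i j
    by_cases hij : i = j <;> simp [hij]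
  rw [hd, Matrix.mul_add, Matrix.add_mul, mul_one, eigenvectorUnitary_map_mul_transpose,
    Matrix.mul_smul, Matrix.smul_mul, ← map_ofReal_eq_conj_diagonal]

theorem det_one_add_smul_map_ofReal {ι : Type*} [Fintype ι] [DecidableEq ι]
    {M : Matrix ι ι ℝ} (h : M.IsHermitian) (z : ℂ) :
    (1 + z • M.map ofReal).det = ∏ j, (1 + z * (h.eigenvalues j : ℂ)) := by
  have hV := congrArg det (eigenvectorUnitary_map_mul_transpose h)
  rw [det_mul, det_one] at hV
  rw [one_add_smul_map_ofReal_eq h, det_mul, det_mul, mul_right_comm, hV, one_mul, det_diagonal]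

theorem one_add_mul_I_eq_exp_arctan (x : ℝ) :
    1 + x * I = (√(1 + x ^ 2) : ℝ) * exp ((Real.arctan x : ℝ) * I) := by
  have : √(1 + x ^ 2) ≠ 0 := by positivity
  apply Complex.ext
  · rw [re_ofReal_mul, exp_ofReal_mul_I_re, Real.cos_arctan, mul_one_div_cancel this]
    simp
  · rw [im_ofReal_mul, exp_ofReal_mul_I_im, Real.sin_arctan, mul_div_cancel₀ _ this]
    simp

theorem prod_one_add_mul_I_eq {ι : Type*} [Fintype ι] (x : ι → ℝ) :
    ∏ j, (1 + x j * I) = (∏ j, √(1 + x j ^ 2) : ℝ) *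
      exp ((∑ j, Real.arctan (x j) : ℝ) * I) := by
  simp only [one_add_mul_I_eq_exp_arctan, Finset.prod_mul_distrib, ofReal_prod, ofReal_sum,
    Finset.sum_mul, exp_sum]

/-- Schur complement formula for `1 + z A`, with `A` a bordered matrix, in the eigenbasis of the
lower-right block. -/
theorem det_one_add_smul_borderedMat {n : ℕ} (a : ℝ) (b : Fin n → ℝ)
    {S : Matrix (Fin n) (Fin n) ℝ} (h : S.IsHermitian) (z : ℂ)
    (hz : ∀ j, 1 + z * (h.eigenvalues j : ℂ) ≠ 0) :
    (1 + z • (borderedMat a b S).map ofReal).det =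
      (∏ j, (1 + z * (h.eigenvalues j : ℂ))) * (1 + z * a - z ^ 2 *
        ∑ j, ((((h.eigenvectorUnitary : Matrix (Fin n) (Fin n) ℝ)ᵀ *ᵥ b) j : ℝ) : ℂ) ^ 2 /
          (1 + z * (h.eigenvalues j : ℂ))) := by
  set V := (h.eigenvectorUnitary : Matrix (Fin n) (Fin n) ℝ).map ofReal with hV
  have hVV : V * Vᵀ = 1 := eigenvectorUnitary_map_mul_transpose h
  have hVV' : Vᵀ * V = 1 := mul_eq_one_comm.mp hVV
  set d : Fin n → ℂ := fun j => 1 + z * (h.eigenvalues j : ℂ)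
  have hX : 1 + z • S.map ofReal = V * diagonal d * Vᵀ := one_add_smul_map_ofReal_eq h z
  have hdd : diagonal d * diagonal (fun j => (d j)⁻¹) = 1 := by
    rw [diagonal_mul_diagonal, ← diagonal_one]
    congr 1
    ext j
    exact mul_inv_cancel₀ (hz j)
  let Y := V * diagonal (fun j => (d j)⁻¹) * Vᵀ
  have hXY : (1 + z • S.map ofReal) * Y = 1 := by
    calc (1 + z • S.map ofReal) * Y
        = V * (diagonal d * ((Vᵀ * V) * diagonal (fun j => (d j)⁻¹))) * Vᵀ := by
          rw [hX]; simp only [Y, Matrix.mul_assoc]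
      _ = 1 := by rw [hVV', one_mul, hdd, mul_one, hVV]
  let : Invertible (1 + z • S.map ofReal) := invertibleOfRightInverse _ Y hXY
  have hinv : ⅟(1 + z • S.map ofReal) = Y := rfl
  set B : Matrix Unit (Fin n) ℂ := Matrix.of fun _ j => (b j : ℂ) with hB
  have hblock : 1 + z • (borderedMat a b S).map ofReal =
      fromBlocks (1 + z • Matrix.of fun _ _ : Unit => (a : ℂ)) (z • B) (z • Bᵀ)
        (1 + z • S.map ofReal) := by
    rw [← fromBlocks_one]
    ext (i | i) (j | j) <;> simp [borderedMat, hB, Matrix.one_apply]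
  have hquad : (z • B * Y * (z • Bᵀ)) () () = z ^ 2 *
      ∑ j, ((((h.eigenvectorUnitary : Matrix (Fin n) (Fin n) ℝ)ᵀ *ᵥ b) j : ℝ) : ℂ) ^ 2 / d j := by
    have hc : ∀ j, (B * V) () j =
        ((((h.eigenvectorUnitary : Matrix (Fin n) (Fin n) ℝ)ᵀ *ᵥ b) j : ℝ) : ℂ) := by
      intro j
      simp [Matrix.mul_apply, mulVec, dotProduct, hB, hV, mul_comm]
    have : z • B * Y * (z • Bᵀ) =
        z ^ 2 • ((B * V) * diagonal (fun j => (d j)⁻¹) * (B * V)ᵀ) := by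
      simp only [Y, Matrix.smul_mul, Matrix.mul_smul, smul_smul, transpose_mul, Matrix.mul_assoc,
        pow_two]
    rw [this, Matrix.smul_apply, Matrix.mul_apply, smul_eq_mul]
    congr 1
    refine Finset.sum_congr rfl fun j _ => ?_
    rw [mul_diagonal, transpose_apply, hc]
    ring
  rw [hblock, det_fromBlocks₂₂, hinv, det_one_add_smul_map_ofReal h, det_unique]
  congr 1
  rw [Matrix.sub_apply]
  change _ - (z • B * Y * (z • Bᵀ)) () () = _
  rw [hquad]
  simp [d]

theorem sum_sq_eigenvectorUnitary_mulVec {ι : Type*} [Fintype ι] [DecidableEq ι]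
    {M : Matrix ι ι ℝ} (h : M.IsHermitian) (b : ι → ℝ) :
    ∑ j, (((h.eigenvectorUnitary : Matrix ι ι ℝ)ᵀ *ᵥ b) j) ^ 2 = ∑ j, b j ^ 2 := by
  have h1 := Unitary.mul_star_self_of_mem h.eigenvectorUnitary.2
  rw [Matrix.star_eq_conjTranspose, Matrix.conjTranspose_eq_transpose_of_trivial] at h1
  set U := (h.eigenvectorUnitary : Matrix ι ι ℝ)
  calc ∑ j, ((Uᵀ *ᵥ b) j) ^ 2 = (Uᵀ *ᵥ b) ⬝ᵥ (Uᵀ *ᵥ b) := by simp [dotProduct, pow_two]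
    _ = b ⬝ᵥ ((U * Uᵀ) *ᵥ b) := by
      rw [dotProduct_mulVec, vecMul_transpose, mulVec_mulVec, dotProduct_comm]
    _ = ∑ j, b j ^ 2 := by rw [h1, one_mulVec]; simp [dotProduct, pow_two]

theorem borderedMat_isHermitian {n : ℕ} (a : ℝ) (b : Fin n → ℝ)
    {S : Matrix (Fin n) (Fin n) ℝ} (h : S.IsHermitian) : (borderedMat a b S).IsHermitian := by
  refine IsHermitian.fromBlocks ?_ ?_ h
  · ext; simp
  · ext; simp

/-- A continuous function on `[0, 1]` that vanishes at `0` and has positive cosine throughout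
ends in `(-π/2, π/2)`. -/
theorem abs_lt_pi_div_two_of_cos_pos {θ : ℝ → ℝ} (hθ : Continuous θ) (h0 : θ 0 = 0)
    (hcos : ∀ t, 0 < Real.cos (θ t)) : |θ 1| < Real.pi / 2 := by
  by_contra! hge
  obtain ⟨t, -, ht⟩ := intermediate_value_Icc (zero_le_one' ℝ)
    (f := fun t => |θ t|) hθ.abs.continuousOn
    (show Real.pi / 2 ∈ _ from ⟨by simpa [h0] using Real.pi_div_two_pos.le, hge⟩)
  have := hcos t
  rw [← Real.cos_abs] at this
  simp only at ht
  rw [ht, Real.cos_pi_div_two] at this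
  exact this.false

/-- The phase of a bordered matrix, in terms of the spectral data of its lower-right block. -/
theorem lagPhase_borderedMat {n : ℕ} (a : ℝ) (b : Fin n → ℝ)
    {S : Matrix (Fin n) (Fin n) ℝ} (h : S.IsHermitian) :
    ∃ c μ : Fin n → ℝ, ∑ j, c j ^ 2 = ∑ j, b j ^ 2 ∧
      lagPhase (borderedMat a b S) = lagPhase S +
        Real.arctan ((a - ∑ j, c j ^ 2 * (μ j / (1 + μ j ^ 2))) /
          (1 + ∑ j, c j ^ 2 / (1 + μ j ^ 2))) := by
  have hA := borderedMat_isHermitian a b h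
  refine ⟨(h.eigenvectorUnitary : Matrix (Fin n) (Fin n) ℝ)ᵀ *ᵥ b, h.eigenvalues,
    sum_sq_eigenvectorUnitary_mulVec h b, ?_⟩
  rw [lagPhase, lagPhase, dif_pos hA, dif_pos h]
  set c := (h.eigenvectorUnitary : Matrix (Fin n) (Fin n) ℝ)ᵀ *ᵥ b with hc
  set μ := h.eigenvalues with hμ
  set θ : ℝ → ℝ := fun t =>
    ∑ j, Real.arctan (t * hA.eigenvalues j) - ∑ j, Real.arctan (t * μ j) with hθ
  have key : ∀ t : ℝ, ∃ r : ℝ, 0 < r ∧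
      r * Real.cos (θ t) = 1 + t ^ 2 * ∑ j, c j ^ 2 / (1 + (t * μ j) ^ 2) ∧
      r * Real.sin (θ t) =
        t * a - t ^ 2 * ∑ j, c j ^ 2 * (t * μ j / (1 + (t * μ j) ^ 2)) := by
    intro t
    have hne : ∀ j, 1 + (t * I) * (μ j : ℂ) ≠ 0 := fun j h0 => by
      simpa using congrArg re h0
    have hdet := det_one_add_smul_borderedMat a b h (t * I) hne
    rw [det_one_add_smul_map_ofReal hA] at hdet
    have hform : ∀ {ι : Type} [Fintype ι] (x : ι → ℝ), ∏ j, (1 + (t * I) * (x j : ℂ)) =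
        (∏ j, √(1 + (t * x j) ^ 2) : ℝ) *
          exp ((∑ j, Real.arctan (t * x j) : ℝ) * I) := by
      intro ι _ x
      rw [← prod_one_add_mul_I_eq]
      refine Finset.prod_congr rfl fun j _ => ?_
      push_cast
      ring
    rw [hform, hform, ← hμ, ← hc] at hdet
    have hP : 0 < ∏ j, √(1 + (t * hA.eigenvalues j) ^ 2) :=
      Finset.prod_pos fun j _ => by positivity
    have hQ : 0 < ∏ j, √(1 + (t * μ j) ^ 2) := Finset.prod_pos fun j _ => by positivity
    set P := ∏ j, √(1 + (t * hA.eigenvalues j) ^ 2)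
    set Q := ∏ j, √(1 + (t * μ j) ^ 2)
    have hterm : ∀ j, ((c j : ℝ) : ℂ) ^ 2 / (1 + (t * I) * (μ j : ℂ)) =
        ((c j ^ 2 / (1 + (t * μ j) ^ 2) : ℝ) : ℂ) -
          ((c j ^ 2 * (t * μ j / (1 + (t * μ j) ^ 2)) : ℝ) : ℂ) * I := by
      intro j
      have h1 : (1 + (t * μ j : ℂ) ^ 2) ≠ 0 := by
        have : (1 + (t * μ j) ^ 2 : ℝ) ≠ 0 := by positivity
        exact_mod_cast this
      rw [div_eq_iff (hne j)]
      push_cast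
      simp only [div_eq_mul_inv]
      linear_combination (-(c j : ℂ) ^ 2) * mul_inv_cancel₀ h1 +
        (c j : ℂ) ^ 2 * (t * μ j) ^ 2 * (1 + (t * μ j : ℂ) ^ 2)⁻¹ * I_sq
    have hexp : ((P / Q : ℝ) : ℂ) * exp ((θ t : ℝ) * I) =
        1 + (t * I) * a - (t * I) ^ 2 * ∑ j, ((c j : ℝ) : ℂ) ^ 2 / (1 + (t * I) * (μ j : ℂ)) := by
      have hQ' : (Q : ℂ) ≠ 0 := by exact_mod_cast hQ.ne'
      rw [hθ, ofReal_sub, sub_mul, exp_sub, ofReal_div, div_mul_div_comm, hdet]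
      field_simp
    have hrhs : 1 + (t * I) * a -
          (t * I) ^ 2 * ∑ j, ((c j : ℝ) : ℂ) ^ 2 / (1 + (t * I) * (μ j : ℂ)) =
        ((1 + t ^ 2 * ∑ j, c j ^ 2 / (1 + (t * μ j) ^ 2) : ℝ) : ℂ) +
          ((t * a - t ^ 2 * ∑ j, c j ^ 2 * (t * μ j / (1 + (t * μ j) ^ 2)) : ℝ) : ℂ) * I := by
      simp only [hterm, Finset.sum_sub_distrib, ← Finset.sum_mul, ← ofReal_sum, mul_pow, I_sq]
      push_cast
      ring
    refine ⟨P / Q, by positivity, ?_, ?_⟩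
    · have := congrArg re hexp
      rwa [re_ofReal_mul, exp_ofReal_mul_I_re, hrhs, add_re, ofReal_re, re_ofReal_mul, I_re,
        mul_zero, add_zero] at this
    · have := congrArg im hexp
      rwa [im_ofReal_mul, exp_ofReal_mul_I_im, hrhs, add_im, ofReal_im, im_ofReal_mul, I_im,
        mul_one, zero_add] at this
  have hcont : Continuous θ := by fun_prop
  have hcos : ∀ t, 0 < Real.cos (θ t) := fun t => by
    obtain ⟨r, hr, hre, -⟩ := key t
    have : 0 < r * Real.cos (θ t) := by
      rw [hre]
      have : 0 ≤ ∑ j, c j ^ 2 / (1 + (t * μ j) ^ 2) :=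
        Finset.sum_nonneg fun j _ => by positivity
      positivity
    exact pos_of_mul_pos_right this hr.le
  have hlt := abs_lt.mp (abs_lt_pi_div_two_of_cos_pos hcont (by simp [hθ]) hcos)
  obtain ⟨r, hr, hre, him⟩ := key 1
  simp only [one_mul, one_pow] at hre him
  have htan : (a - ∑ j, c j ^ 2 * (μ j / (1 + μ j ^ 2))) /
      (1 + ∑ j, c j ^ 2 / (1 + μ j ^ 2)) = Real.tan (θ 1) := by
    rw [← hre, ← him, mul_div_mul_left _ _ hr.ne', Real.tan_eq_sin_div_cos]
  rw [htan, Real.arctan_tan hlt.1 hlt.2]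
  simp [hθ]

end

/-- Let `K` be a compact set of `n × n` real symmetric matrices and
`C > 0`. For every `ε > 0` there is `Λ₀ > 0` such that for all `λ ≥ Λ₀`, all
`τ ∈ (0, 1]`, all `S ∈ K`, and all `b` with `|b_j| ≤ C`, the bordered matrix `A` with
corner `λ/τ`, border `b_j/√τ` and lower-right block `S` satisfies
`|ϑ(A) - (π/2 + ϑ(S))| < ε`. -/
theorem stmt13 {n : ℕ} (K : Set (Matrix (Fin n) (Fin n) ℝ)) (hK : IsCompact K)
    (hKsymm : ∀ S ∈ K, S.IsSymm) (C : ℝ) (hC : 0 < C) :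
    ∀ ε > (0 : ℝ), ∃ Λ₀ > (0 : ℝ), ∀ lam : ℝ, Λ₀ ≤ lam →
      ∀ τ ∈ Set.Ioc (0 : ℝ) 1, ∀ S ∈ K, ∀ b : Fin n → ℝ, (∀ j, |b j| ≤ C) →
        |lagPhase (borderedMat (lam / τ) (fun j => b j / Real.sqrt τ) S)
            - (Real.pi / 2 + lagPhase S)| < ε := by
  intro ε hε
  obtain ⟨y, hy⟩ := Filter.eventually_atTop.mp
    ((Real.tendsto_arctan_atTop.mono_right nhdsWithin_le_nhds).eventually
      (lt_mem_nhds (show Real.pi / 2 - ε < Real.pi / 2 by linarith)))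
  set N : ℝ := n * C ^ 2 with hN
  have hN0 : 0 ≤ N := by positivity
  refine ⟨|y| * (1 + N) + N + 1, by positivity, fun lam hlam τ hτ S hS b hb => ?_⟩
  obtain ⟨hτ0, hτ1⟩ := hτ
  have hSh : S.IsHermitian := by
    rw [Matrix.IsHermitian, Matrix.conjTranspose_eq_transpose_of_trivial]
    exact hKsymm S hS
  obtain ⟨c, μ, hc, hphase⟩ :=
    lagPhase_borderedMat (lam / τ) (fun j => b j / Real.sqrt τ) hSh
  have hcN : ∑ j, c j ^ 2 ≤ N / τ := by
    rw [hc, hN]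
    calc ∑ j, (b j / Real.sqrt τ) ^ 2 ≤ ∑ _j : Fin n, C ^ 2 / τ := by
          refine Finset.sum_le_sum fun j _ => ?_
          rw [div_pow, Real.sq_sqrt hτ0.le]
          have := sq_le_sq' (neg_le_of_abs_le (hb j)) (le_of_abs_le (hb j))
          gcongr
      _ = n * C ^ 2 / τ := by simp; ring
  have hden : ∑ j, c j ^ 2 / (1 + μ j ^ 2) ≤ N / τ :=
    (Finset.sum_le_sum fun j _ => div_le_self (sq_nonneg _)
      (by nlinarith [sq_nonneg (μ j)])).trans hcN
  have hden0 : 0 ≤ ∑ j, c j ^ 2 / (1 + μ j ^ 2) :=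
    Finset.sum_nonneg fun j _ => by positivity
  have hnum : ∑ j, c j ^ 2 * (μ j / (1 + μ j ^ 2)) ≤ N / τ := by
    refine (Finset.sum_le_sum fun j _ => mul_le_of_le_one_right (sq_nonneg _) ?_).trans hcN
    rw [div_le_one (by positivity)]
    nlinarith [sq_nonneg (μ j - 1), sq_nonneg (μ j)]
  have hyle : y ≤ (lam / τ - ∑ j, c j ^ 2 * (μ j / (1 + μ j ^ 2))) /
      (1 + ∑ j, c j ^ 2 / (1 + μ j ^ 2)) := by
    rw [le_div_iff₀ (by positivity)]
    have h1 : 1 ≤ 1 / τ := by rwa [le_div_iff₀ hτ0, one_mul]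
    calc y * (1 + ∑ j, c j ^ 2 / (1 + μ j ^ 2))
        ≤ |y| * (1 + ∑ j, c j ^ 2 / (1 + μ j ^ 2)) := by gcongr; exact le_abs_self y
      _ ≤ |y| * (1 / τ + N / τ) := by gcongr
      _ = (|y| * (1 + N) + N) / τ - N / τ := by ring
      _ ≤ lam / τ - N / τ := by gcongr; linarith
      _ ≤ _ := by gcongr
  have hlow := hy _ hyle
  have hup := Real.arctan_lt_pi_div_two ((lam / τ - ∑ j, c j ^ 2 * (μ j / (1 + μ j ^ 2))) /
      (1 + ∑ j, c j ^ 2 / (1 + μ j ^ 2)))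
  rw [hphase, abs_lt]
  constructor <;> linarith
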